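/- Let m ≥ 1 be an integer, let X be a real or complex Banach space, and let T, P be bounded linear operators on X such that ‖Tⁿ‖_e/n → 0 and ‖M_n(T) − P‖_e → 0 as n → ∞. Define, for n ≥ 1, the operator f_n(T) := (n·I + (n−1)T + (n−2)T² + … + T^{n−1})/(n+1). Then ‖(I − P) − f_n(T)^m (I − T)^m‖_e → 0 as n → ∞; equivalently, there exist compact operators K_n on X such that ‖(I − P) − (f_n(T)^m (I − T)^m + K_n)‖ → 0. -/

import Mathlib

open Filter Topology

/-- The essential norm of an operator: its distance to the compact operators. -/
noncomputable def essNorm {𝕜 X Y : Type*} [RCLike 𝕜] [NormedAddCommGroup X]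
    [NormedSpace 𝕜 X] [NormedAddCommGroup Y] [NormedSpace 𝕜 Y] (T : X →L[𝕜] Y) : ℝ :=
  sInf {c | ∃ K : X →L[𝕜] Y, IsCompactOperator K ∧ c = ‖T - K‖}

/-- The Cesàro means `M_n(T) = (I + T + … + Tⁿ)/(n+1)` of an operator `T`. -/
noncomputable def cesaroMean {𝕜 X : Type*} [RCLike 𝕜] [NormedAddCommGroup X]
    [NormedSpace 𝕜 X] (T : X →L[𝕜] X) (n : ℕ) : X →L[𝕜] X :=
  ((n : 𝕜) + 1)⁻¹ • ∑ k ∈ Finset.range (n + 1), T ^ k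

/-- `f_n(T) = (n·I + (n-1)T + (n-2)T² + … + T^{n-1})/(n+1)`. -/
noncomputable def fPoly {𝕜 X : Type*} [RCLike 𝕜] [NormedAddCommGroup X]
    [NormedSpace 𝕜 X] (T : X →L[𝕜] X) (n : ℕ) : X →L[𝕜] X :=
  ((n : 𝕜) + 1)⁻¹ • ∑ k ∈ Finset.range n, ((n : 𝕜) - (k : 𝕜)) • T ^ k

section EssNorm

variable {𝕜 X : Type*} [RCLike 𝕜] [NormedAddCommGroup X] [NormedSpace 𝕜 X]

theorem essNorm_le_norm_sub {T K : X →L[𝕜] X} (hK : IsCompactOperator K) :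
    essNorm T ≤ ‖T - K‖ :=
  csInf_le ⟨0, by rintro _ ⟨K, -, rfl⟩; exact norm_nonneg _⟩ ⟨K, hK, rfl⟩

theorem essNorm_set_nonempty (T : X →L[𝕜] X) :
    {c | ∃ K : X →L[𝕜] X, IsCompactOperator K ∧ c = ‖T - K‖}.Nonempty :=
  ⟨_, 0, isCompactOperator_zero, rfl⟩

theorem essNorm_nonneg (T : X →L[𝕜] X) : 0 ≤ essNorm T :=
  Real.sInf_nonneg (by rintro _ ⟨K, -, rfl⟩; exact norm_nonneg _)

theorem essNorm_le_norm (T : X →L[𝕜] X) : essNorm T ≤ ‖T‖ := by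
  simpa using essNorm_le_norm_sub (T := T) (K := 0) isCompactOperator_zero

theorem exists_isCompactOperator_norm_sub_lt {T : X →L[𝕜] X} {c : ℝ} (h : essNorm T < c) :
    ∃ K : X →L[𝕜] X, IsCompactOperator K ∧ ‖T - K‖ < c := by
  obtain ⟨_, ⟨K, hK, rfl⟩, hlt⟩ := exists_lt_of_csInf_lt (essNorm_set_nonempty T) h
  exact ⟨K, hK, hlt⟩

@[simp]
theorem essNorm_zero : essNorm (0 : X →L[𝕜] X) = 0 :=
  le_antisymm (by simpa using essNorm_le_norm (0 : X →L[𝕜] X)) (essNorm_nonneg _)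

theorem essNorm_add_le (A B : X →L[𝕜] X) : essNorm (A + B) ≤ essNorm A + essNorm B := by
  refine le_add_of_forall_lt fun a ha b hb => ?_
  obtain ⟨K, hK, hKa⟩ := exists_isCompactOperator_norm_sub_lt ha
  obtain ⟨L, hL, hLb⟩ := exists_isCompactOperator_norm_sub_lt hb
  calc essNorm (A + B) ≤ ‖A + B - (K + L)‖ := essNorm_le_norm_sub (hK.add hL)
    _ = ‖(A - K) + (B - L)‖ := by congr 1; abel
    _ ≤ a + b := (norm_add_le _ _).trans (add_le_add hKa.le hLb.le)

theorem essNorm_mul_le (A B : X →L[𝕜] X) : essNorm (A * B) ≤ essNorm A * essNorm B := by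
  refine le_mul_of_forall_lt₀ fun a ha b hb => ?_
  obtain ⟨K, hK, hKa⟩ := exists_isCompactOperator_norm_sub_lt ha
  obtain ⟨L, hL, hLb⟩ := exists_isCompactOperator_norm_sub_lt hb
  have hc : IsCompactOperator (A * L + K * (B - L)) :=
    (hL.clm_comp A).add (hK.comp_clm (B - L))
  calc essNorm (A * B) ≤ ‖A * B - (A * L + K * (B - L))‖ := essNorm_le_norm_sub hc
    _ = ‖(A - K) * (B - L)‖ := by congr 1; noncomm_ring
    _ ≤ ‖A - K‖ * ‖B - L‖ := norm_mul_le _ _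
    _ ≤ a * b := mul_le_mul hKa.le hLb.le (norm_nonneg _) ((norm_nonneg _).trans hKa.le)

theorem essNorm_smul_le (c : 𝕜) (A : X →L[𝕜] X) : essNorm (c • A) ≤ ‖c‖ * essNorm A := by
  have h1 : essNorm (c • (1 : X →L[𝕜] X)) ≤ ‖c‖ :=
    (essNorm_le_norm _).trans <| (norm_smul_le c (1 : X →L[𝕜] X)).trans <|
      mul_le_of_le_one_right (norm_nonneg _) ContinuousLinearMap.norm_id_le
  calc essNorm (c • A) = essNorm ((c • (1 : X →L[𝕜] X)) * A) := by rw [smul_mul_assoc, one_mul]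
    _ ≤ essNorm (c • (1 : X →L[𝕜] X)) * essNorm A := essNorm_mul_le _ _
    _ ≤ ‖c‖ * essNorm A := mul_le_mul_of_nonneg_right h1 (essNorm_nonneg _)

theorem essNorm_neg (A : X →L[𝕜] X) : essNorm (-A) = essNorm A := by
  have h (B : X →L[𝕜] X) : essNorm (-B) ≤ essNorm B := by
    simpa using essNorm_smul_le (-1 : 𝕜) B
  exact le_antisymm (h A) (by simpa using h (-A))

theorem essNorm_sub_comm (A B : X →L[𝕜] X) : essNorm (A - B) = essNorm (B - A) := by
  rw [← essNorm_neg, neg_sub]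

theorem essNorm_sub_le (A B : X →L[𝕜] X) : essNorm (A - B) ≤ essNorm A + essNorm B := by
  simpa [sub_eq_add_neg, essNorm_neg] using essNorm_add_le A (-B)

theorem essNorm_sub_le_add (A B C : X →L[𝕜] X) :
    essNorm (A - C) ≤ essNorm (A - B) + essNorm (B - C) := by
  simpa using essNorm_add_le (A - B) (B - C)

theorem tendsto_essNorm_mul_sub {a b : ℕ → X →L[𝕜] X} {A B : X →L[𝕜] X}
    (ha : Tendsto (fun n => essNorm (a n - A)) atTop (𝓝 0))
    (hb : Tendsto (fun n => essNorm (b n - B)) atTop (𝓝 0)) :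
    Tendsto (fun n => essNorm (a n * b n - A * B)) atTop (𝓝 0) := by
  have hlim : Tendsto (fun n => essNorm (a n - A) * (essNorm (b n - B) + essNorm B)
      + essNorm A * essNorm (b n - B)) atTop (𝓝 0) := by
    simpa using (ha.mul (hb.add_const (essNorm B))).add (hb.const_mul (essNorm A))
  refine squeeze_zero (fun _ => essNorm_nonneg _) (fun n => ?_) hlim
  have hbn : essNorm (b n) ≤ essNorm (b n - B) + essNorm B := by
    simpa using essNorm_add_le (b n - B) B
  calc essNorm (a n * b n - A * B)
      = essNorm ((a n - A) * b n + A * (b n - B)) := by congr 1; noncomm_ring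
    _ ≤ essNorm ((a n - A) * b n) + essNorm (A * (b n - B)) := essNorm_add_le _ _
    _ ≤ essNorm (a n - A) * essNorm (b n) + essNorm A * essNorm (b n - B) :=
        add_le_add (essNorm_mul_le _ _) (essNorm_mul_le _ _)
    _ ≤ _ := by gcongr; exact essNorm_nonneg _

theorem tendsto_essNorm_pow_sub {a : ℕ → X →L[𝕜] X} {A : X →L[𝕜] X}
    (ha : Tendsto (fun n => essNorm (a n - A)) atTop (𝓝 0)) (m : ℕ) :
    Tendsto (fun n => essNorm (a n ^ m - A ^ m)) atTop (𝓝 0) := by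
  induction m with
  | zero => simp
  | succ k ih => simpa only [pow_succ] using tendsto_essNorm_mul_sub ih ha

theorem essNorm_sub_eq_zero_of_tendsto {a : ℕ → X →L[𝕜] X} {A B : X →L[𝕜] X}
    (hA : Tendsto (fun n => essNorm (a n - A)) atTop (𝓝 0))
    (hB : Tendsto (fun n => essNorm (a n - B)) atTop (𝓝 0)) : essNorm (A - B) = 0 := by
  refine le_antisymm (ge_of_tendsto' (by simpa using hA.add hB) fun n => ?_) (essNorm_nonneg _)
  rw [essNorm_sub_comm (a n) A]
  exact essNorm_sub_le_add _ _ _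

theorem essNorm_mul_eq_zero_of_left {A : X →L[𝕜] X} (hA : essNorm A = 0) (B : X →L[𝕜] X) :
    essNorm (A * B) = 0 :=
  le_antisymm ((essNorm_mul_le A B).trans (by simp [hA])) (essNorm_nonneg _)

theorem essNorm_pow_sub_self_eq_zero {Q : X →L[𝕜] X} (hQ : essNorm (Q * Q - Q) = 0)
    {m : ℕ} (hm : 1 ≤ m) : essNorm (Q ^ m - Q) = 0 := by
  induction m, hm using Nat.le_induction with
  | base => simp
  | succ k _ ih =>
    refine le_antisymm ?_ (essNorm_nonneg _)
    calc essNorm (Q ^ (k + 1) - Q) ≤ essNorm (Q ^ (k + 1) - Q * Q) + essNorm (Q * Q - Q) :=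
          essNorm_sub_le_add _ _ _
      _ = 0 := by rw [hQ, pow_succ, ← sub_mul, essNorm_mul_eq_zero_of_left ih, add_zero]

theorem sum_range_sub_smul_pow_mul_one_sub (T : X →L[𝕜] X) (n : ℕ) :
    (∑ k ∈ Finset.range n, ((n : 𝕜) - (k : 𝕜)) • T ^ k) * (1 - T)
      = ((n : 𝕜) + 1) • 1 - ∑ k ∈ Finset.range (n + 1), T ^ k := by
  induction n with
  | zero => simp
  | succ n ih =>
    have hstep : (∑ k ∈ Finset.range (n + 1), (((n + 1 : ℕ) : 𝕜) - (k : 𝕜)) • T ^ k)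
        = (∑ k ∈ Finset.range n, ((n : 𝕜) - (k : 𝕜)) • T ^ k)
          + ∑ k ∈ Finset.range (n + 1), T ^ k := by
      have hext : (∑ k ∈ Finset.range n, ((n : 𝕜) - (k : 𝕜)) • T ^ k)
          = ∑ k ∈ Finset.range (n + 1), ((n : 𝕜) - (k : 𝕜)) • T ^ k := by
        simp [Finset.sum_range_succ]
      rw [hext, ← Finset.sum_add_distrib]
      refine Finset.sum_congr rfl fun k _ => ?_
      push_cast
      module
    rw [hstep, add_mul, ih, geom_sum_mul_neg, Finset.sum_range_succ _ (n + 1)]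
    push_cast
    module

theorem fPoly_mul_one_sub (T : X →L[𝕜] X) (n : ℕ) :
    fPoly T n * (1 - T) = 1 - cesaroMean T n := by
  have h : (n : 𝕜) + 1 ≠ 0 := Nat.cast_add_one_ne_zero n
  rw [fPoly, cesaroMean, smul_mul_assoc, sum_range_sub_smul_pow_mul_one_sub, smul_sub, smul_smul,
    inv_mul_cancel₀ h, one_smul]

theorem commute_fPoly_one_sub (T : X →L[𝕜] X) (n : ℕ) : Commute (fPoly T n) (1 - T) := by
  refine ((Commute.one_right _).sub_right ?_)
  exact (Commute.sum_left _ _ _ fun k _ =>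
    ((Commute.refl T).pow_left k).smul_left _).smul_left _

theorem cesaroMean_mul_one_sub (T : X →L[𝕜] X) (n : ℕ) :
    cesaroMean T n * (1 - T) = ((n : 𝕜) + 1)⁻¹ • (1 - T ^ (n + 1)) := by
  rw [cesaroMean, smul_mul_assoc, geom_sum_mul_neg]

theorem tendsto_essNorm_cesaroMean_mul_one_sub {T : X →L[𝕜] X}
    (hT : Tendsto (fun n : ℕ => essNorm (T ^ n) / n) atTop (𝓝 0)) :
    Tendsto (fun n => essNorm (cesaroMean T n * (1 - T))) atTop (𝓝 0) := by
  have h1 : Tendsto (fun n : ℕ => essNorm (1 : X →L[𝕜] X) / ((n + 1 : ℕ) : ℝ)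
      + essNorm (T ^ (n + 1)) / ((n + 1 : ℕ) : ℝ)) atTop (𝓝 0) := by
    simpa [Function.comp_def] using ((tendsto_const_div_atTop_nhds_zero_nat (essNorm (1 : X →L[𝕜] X))).add hT).comp
      (tendsto_add_atTop_nat 1)
  refine squeeze_zero (fun _ => essNorm_nonneg _) (fun n => ?_) h1
  have hn : ‖((n : 𝕜) + 1)⁻¹‖ = ((n + 1 : ℕ) : ℝ)⁻¹ := by
    rw [norm_inv, ← Nat.cast_add_one, RCLike.norm_natCast]
  rw [cesaroMean_mul_one_sub, ← add_div, div_eq_inv_mul, ← hn]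
  exact (essNorm_smul_le _ _).trans
    (mul_le_mul_of_nonneg_left (essNorm_sub_le _ _) (norm_nonneg _))

/-- The limit of the Cesàro means in the Calkin algebra is idempotent there. -/
theorem essNorm_mul_self_sub_eq_zero {T P : X →L[𝕜] X}
    (hT : Tendsto (fun n : ℕ => essNorm (T ^ n) / n) atTop (𝓝 0))
    (hP : Tendsto (fun n : ℕ => essNorm (cesaroMean T n - P)) atTop (𝓝 0)) :
    essNorm (P * P - P) = 0 := by
  have hPT : essNorm (P * (1 - T)) = 0 := by
    simpa using essNorm_sub_eq_zero_of_tendsto (B := 0)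
      (tendsto_essNorm_mul_sub hP (b := fun _ => 1 - T) (B := 1 - T) (by simp))
      (by simpa using tendsto_essNorm_cesaroMean_mul_one_sub hT)
  refine essNorm_sub_eq_zero_of_tendsto (a := fun n => P * cesaroMean T n)
    (tendsto_essNorm_mul_sub (a := fun _ => P) (by simp) hP) ?_
  have h0 (n : ℕ) : essNorm (P * cesaroMean T n - P) = 0 := by
    have h : P - P * cesaroMean T n = P * (1 - T) * fPoly T n := by
      rw [mul_assoc, ← (commute_fPoly_one_sub T n).eq, fPoly_mul_one_sub, mul_sub, mul_one]
    rw [essNorm_sub_comm, h, essNorm_mul_eq_zero_of_left hPT]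
  simp [h0]

end EssNorm

/-- If `‖Tⁿ‖ₑ/n → 0` and the Cesàro means of `T` converge to `P` in the Calkin algebra,
then `‖(I - P) - f_n(T)^m (I - T)^m‖ₑ → 0` for every `m ≥ 1`. -/
theorem essNorm_sub_fPoly_pow_tendsto_zero
    {𝕜 X : Type*} [RCLike 𝕜] [NormedAddCommGroup X] [NormedSpace 𝕜 X] [CompleteSpace X]
    (m : ℕ) (hm : 1 ≤ m) (T P : X →L[𝕜] X)
    (hT : Tendsto (fun n : ℕ => essNorm (T ^ n) / n) atTop (𝓝 0))
    (hP : Tendsto (fun n : ℕ => essNorm (cesaroMean T n - P)) atTop (𝓝 0)) :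
    Tendsto (fun n : ℕ =>
        essNorm ((1 - P) - fPoly T n ^ m * (1 - T) ^ m : X →L[𝕜] X)) atTop (𝓝 0) := by
  have hQ : essNorm ((1 - P) * (1 - P) - (1 - P)) = 0 := by
    rw [← essNorm_mul_self_sub_eq_zero hT hP]
    congr 1
    noncomm_ring
  have hM : Tendsto (fun n => essNorm ((1 - cesaroMean T n) - (1 - P))) atTop (𝓝 0) := by
    refine hP.congr fun n => ?_
    rw [essNorm_sub_comm, sub_sub_sub_cancel_left]
  refine squeeze_zero (fun _ => essNorm_nonneg _) (fun n => ?_) (tendsto_essNorm_pow_sub hM m)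
  rw [← (commute_fPoly_one_sub T n).mul_pow, fPoly_mul_one_sub, essNorm_sub_comm]
  have h := essNorm_sub_le_add ((1 - cesaroMean T n) ^ m) ((1 - P) ^ m) (1 - P)
  rwa [essNorm_pow_sub_self_eq_zero hQ hm, add_zero] at h
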